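/- arXiv:2309.11403 — 3 statements merged into one kernel-verified Lean document; each statement's English description precedes it below -/
import Mathlib

section
/- Let N be a quantum channel on d×d complex matrices (with Kraus operators Eᵢ, so that N(X) = Σᵢ EᵢXEᵢ† and Σᵢ Eᵢ†Eᵢ = I) that is bijective as a linear map, and let O be a d×d Hermitian matrix. Then there exist a quantum channel C on d×d complex matrices (with Kraus operators Kⱼ), a real number f > 0, and a real number t, such that N†(C†(O)) = (1/f)·(O + t·I), where N†(Y) = Σᵢ Eᵢ†YEᵢ and C†(Y) = Σⱼ Kⱼ†YKⱼ are the adjoint maps. (Observable shift lemma.) -/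
open Matrix BigOperators
open scoped ComplexOrder

theorem obs_sq_decomp {d : ℕ} (Y : Matrix (Fin d) (Fin d) ℂ) (hY : Y.IsHermitian) :
    ∃ c : ℝ, 0 < c ∧ ((c : ℂ) • (1 : Matrix (Fin d) (Fin d) ℂ) + Y).PosSemidef ∧
      ((c : ℂ) • (1 : Matrix (Fin d) (Fin d) ℂ) - Y).PosSemidef := by
  have key : ∀ (c : ℝ) (s : ℝ), (∀ i, 0 ≤ c + s * hY.eigenvalues i) →
      ((c : ℂ) • (1 : Matrix (Fin d) (Fin d) ℂ) + (s : ℂ) • Y).PosSemidef := by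
    intro c s h
    have hd : (Matrix.diagonal fun i => ((c + s * hY.eigenvalues i : ℝ) : ℂ)).PosSemidef := by
      apply Matrix.PosSemidef.diagonal
      intro i
      exact Complex.zero_le_real.mpr (h i)
    have h2 := hd.mul_mul_conjTranspose_same (hY.eigenvectorUnitary : Matrix (Fin d) (Fin d) ℂ)
    convert h2 using 1
    have h3 : (Matrix.diagonal fun i => ((c + s * hY.eigenvalues i : ℝ) : ℂ))
        = (c : ℂ) • (1 : Matrix (Fin d) (Fin d) ℂ)
          + (s : ℂ) • Matrix.diagonal (RCLike.ofReal ∘ hY.eigenvalues) := by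
      ext i j
      by_cases hij : i = j
      · subst hij; simp
      · simp [hij]
    have h4 := hY.spectral_theorem
    rw [Unitary.conjStarAlgAut_apply] at h4
    have h5 : (hY.eigenvectorUnitary : Matrix (Fin d) (Fin d) ℂ)
        * (hY.eigenvectorUnitary : Matrix (Fin d) (Fin d) ℂ)ᴴ = 1 :=
      Unitary.coe_mul_star_self hY.eigenvectorUnitary
    rw [h3, Matrix.mul_add, Matrix.add_mul]
    simp only [Matrix.mul_smul, Matrix.smul_mul, Matrix.mul_one]
    rw [h5]
    congr 2
  have hb : ∀ i, |hY.eigenvalues i| ≤ ∑ j, |hY.eigenvalues j| := fun i =>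
    Finset.single_le_sum (f := fun j => |hY.eigenvalues j|) (fun _ _ => abs_nonneg _)
      (Finset.mem_univ i)
  refine ⟨1 + ∑ j, |hY.eigenvalues j|, by positivity, ?_, ?_⟩
  · have := key (1 + ∑ j, |hY.eigenvalues j|) 1
      (fun i => by linarith [hb i, neg_abs_le (hY.eigenvalues i)])
    simpa using this
  · have := key (1 + ∑ j, |hY.eigenvalues j|) (-1)
      (fun i => by linarith [hb i, le_abs_self (hY.eigenvalues i)])
    simpa [sub_eq_add_neg] using this

theorem obs_kraus {d : ℕ} (P : Matrix (Fin d) (Fin d) ℂ) (hP : P.PosSemidef) (u : Fin d → ℂ) :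
    ∃ A : Matrix (Fin d) (Fin d) ℂ, Aᴴ * A = P ∧ ∀ M : Matrix (Fin d) (Fin d) ℂ,
      ∑ k, (vecMulVec u (A k))ᴴ * M * vecMulVec u (A k) = (star u ⬝ᵥ M *ᵥ u) • P := by
  obtain ⟨A, hA⟩ : ∃ A : Matrix (Fin d) (Fin d) ℂ, P = Aᴴ * A := by
    open scoped MatrixOrder in
    exact CStarAlgebra.nonneg_iff_eq_star_mul_self.mp hP.nonneg
  refine ⟨A, hA.symm, fun M => ?_⟩
  have h1 : ∀ k, (vecMulVec u (A k))ᴴ * M * vecMulVec u (A k)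
      = (star u ⬝ᵥ M *ᵥ u) • vecMulVec (star (A k)) (A k) := by
    intro k
    rw [conjTranspose_vecMulVec, Matrix.mul_assoc, mul_vecMulVec, vecMulVec_mul_vecMulVec,
      vecMulVec_smul]
  simp only [h1, ← Finset.smul_sum]
  congr 1
  rw [hA]
  ext i j
  simp [Matrix.sum_apply, vecMulVec_apply, Matrix.mul_apply]

theorem obs_scalar {d : ℕ} (hd : 1 ≤ d) (O : Matrix (Fin d) (Fin d) ℂ) (hO : O.IsHermitian)
    (h : ∀ i j, hO.eigenvalues i ≤ hO.eigenvalues j) :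
    ∃ c : ℂ, O = c • (1 : Matrix (Fin d) (Fin d) ℂ) := by
  refine ⟨(hO.eigenvalues ⟨0, hd⟩ : ℂ), ?_⟩
  have h4 := hO.spectral_theorem
  rw [Unitary.conjStarAlgAut_apply] at h4
  have h3 : Matrix.diagonal (RCLike.ofReal ∘ hO.eigenvalues)
      = (hO.eigenvalues ⟨0, hd⟩ : ℂ) • (1 : Matrix (Fin d) (Fin d) ℂ) := by
    ext i j
    by_cases hij : i = j
    · subst hij; simpa using le_antisymm (h _ _) (h _ _)
    · simp [hij]
  rw [h3, Matrix.mul_smul, Matrix.mul_one, Matrix.smul_mul] at h4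
  have h5 : (hO.eigenvectorUnitary : Matrix (Fin d) (Fin d) ℂ)
      * star (hO.eigenvectorUnitary : Matrix (Fin d) (Fin d) ℂ) = 1 :=
    Unitary.coe_mul_star_self hO.eigenvectorUnitary
  rw [h5] at h4
  exact h4

theorem obs_surj {d m : ℕ} (E : Fin m → Matrix (Fin d) (Fin d) ℂ)
    (hbij : Function.Bijective fun X : Matrix (Fin d) (Fin d) ℂ => ∑ i, E i * X * (E i)ᴴ)
    (O : Matrix (Fin d) (Fin d) ℂ) (hO : O.IsHermitian) :
    ∃ Y : Matrix (Fin d) (Fin d) ℂ, Y.IsHermitian ∧ ∑ i, (E i)ᴴ * Y * E i = O := by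
  let L : Matrix (Fin d) (Fin d) ℂ →ₗ[ℂ] Matrix (Fin d) (Fin d) ℂ :=
    { toFun := fun Y => ∑ i, (E i)ᴴ * Y * E i
      map_add' := fun X Y => by
        simp only [Matrix.mul_add, Matrix.add_mul, Finset.sum_add_distrib]
      map_smul' := fun c X => by
        simp only [Matrix.mul_smul, Matrix.smul_mul, Finset.smul_sum, RingHom.id_apply] }
  have hinj : Function.Injective L := by
    rw [injective_iff_map_eq_zero]
    intro Y hY
    obtain ⟨X, hX⟩ := hbij.2 Yᴴ
    have hY' : ∑ i, (E i)ᴴ * Y * E i = 0 := hY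
    have h1 : (Y * Yᴴ).trace = ((∑ i, (E i)ᴴ * Y * E i) * X).trace := by
      rw [← hX]
      simp only [Matrix.mul_sum, Matrix.sum_mul, Matrix.trace_sum]
      refine Finset.sum_congr rfl fun i _ => ?_
      rw [← Matrix.mul_assoc, Matrix.trace_mul_comm]
      simp only [Matrix.mul_assoc]
    rw [hY', Matrix.zero_mul, Matrix.trace_zero] at h1
    exact Matrix.trace_mul_conjTranspose_self_eq_zero_iff.mp h1
  obtain ⟨Y, hY⟩ := (LinearMap.injective_iff_surjective.mp hinj) O
  refine ⟨Y, hinj ?_, hY⟩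
  have h2 : L Yᴴ = (L Y)ᴴ := by
    simp [L, Matrix.conjTranspose_sum, Matrix.mul_assoc]
  rw [h2, hY]
  exact hO

/-- Observable shift lemma: let `N(X) = Σᵢ EᵢXEᵢ†` (with `Σᵢ Eᵢ†Eᵢ = I`) be a
quantum channel on `d × d` matrices that is bijective as a linear map, and let `O` be Hermitian.
Then there exist a quantum channel `C` with Kraus operators `Kⱼ`, a real `f > 0` and a real `t`
such that `N†(C†(O)) = (1/f)·(O + t·I)`, where `N†(Y) = Σᵢ Eᵢ†YEᵢ` and `C†(Y) = Σⱼ Kⱼ†YKⱼ`. -/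
theorem observable_shift (d : ℕ) (hd : 1 ≤ d)
    (m : ℕ) (E : Fin m → Matrix (Fin d) (Fin d) ℂ)
    (hTP : ∑ i, (E i)ᴴ * E i = 1)
    (hbij : Function.Bijective fun X : Matrix (Fin d) (Fin d) ℂ => ∑ i, E i * X * (E i)ᴴ)
    (O : Matrix (Fin d) (Fin d) ℂ) (hO : O.IsHermitian) :
    ∃ (r : ℕ) (K : Fin r → Matrix (Fin d) (Fin d) ℂ) (f t : ℝ),
      0 < f ∧ (∑ j, (K j)ᴴ * K j = 1) ∧
      (∑ i, (E i)ᴴ * (∑ j, (K j)ᴴ * O * K j) * E i)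
        = ((f⁻¹ : ℝ) : ℂ) • (O + (t : ℂ) • (1 : Matrix (Fin d) (Fin d) ℂ)) := by
  by_cases h : ∀ i j, hO.eigenvalues i ≤ hO.eigenvalues j
  · obtain ⟨c, hc⟩ := obs_scalar hd O hO h
    refine ⟨1, fun _ => 1, 1, 0, one_pos, by simp, ?_⟩
    subst hc
    simp [← Finset.smul_sum, hTP]
  push Not at h
  obtain ⟨j, i, hij⟩ := h
  obtain ⟨Y, hY, hYO⟩ := obs_surj E hbij O hO
  obtain ⟨c, hc, hP, hQ⟩ := obs_sq_decomp Y hY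
  set a := hO.eigenvalues j with ha
  set b := hO.eigenvalues i with hb
  have huu : ∀ k, star (⇑(hO.eigenvectorBasis k)) ⬝ᵥ ⇑(hO.eigenvectorBasis k) = (1 : ℂ) := by
    intro k
    have := hO.eigenvectorBasis.orthonormal.1 k
    have h2 := inner_self_eq_norm_sq_to_K (𝕜 := ℂ) (hO.eigenvectorBasis k)
    rw [this, EuclideanSpace.inner_eq_star_dotProduct, dotProduct_comm] at h2
    simpa using h2
  have huO : ∀ k, star (⇑(hO.eigenvectorBasis k)) ⬝ᵥ O *ᵥ ⇑(hO.eigenvectorBasis k)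
      = (hO.eigenvalues k : ℂ) := by
    intro k
    rw [hO.mulVec_eigenvectorBasis k, dotProduct_smul, huu]
    simp
  have hε : (0 : ℝ) ≤ 1 / (2 * c) := by positivity
  have hε' : (0 : ℂ) ≤ ((1 / (2 * c) : ℝ) : ℂ) := by exact_mod_cast hε
  obtain ⟨A, -, hA⟩ := obs_kraus _ (hP.smul hε') (hO.eigenvectorBasis j)
  obtain ⟨B, -, hB⟩ := obs_kraus _ (hQ.smul hε') (hO.eigenvectorBasis i)
  have hcC : (c : ℂ) ≠ 0 := by exact_mod_cast hc.ne'
  have hab : (0:ℝ) < a - b := by linarith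
  have habC : (a : ℂ) - b ≠ 0 := by exact_mod_cast hab.ne'
  have hsum : ∀ M : Matrix (Fin d) (Fin d) ℂ,
      ∑ k : Fin (d + d), (Fin.append (fun k => vecMulVec (⇑(hO.eigenvectorBasis j)) (A k))
        (fun k => vecMulVec (⇑(hO.eigenvectorBasis i)) (B k)) k)ᴴ * M *
        (Fin.append (fun k => vecMulVec (⇑(hO.eigenvectorBasis j)) (A k))
        (fun k => vecMulVec (⇑(hO.eigenvectorBasis i)) (B k)) k) =
      (star (⇑(hO.eigenvectorBasis j)) ⬝ᵥ M *ᵥ ⇑(hO.eigenvectorBasis j)) •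
        (((1 / (2 * c) : ℝ) : ℂ) • ((c : ℂ) • (1 : Matrix (Fin d) (Fin d) ℂ) + Y)) +
      (star (⇑(hO.eigenvectorBasis i)) ⬝ᵥ M *ᵥ ⇑(hO.eigenvectorBasis i)) •
        (((1 / (2 * c) : ℝ) : ℂ) • ((c : ℂ) • (1 : Matrix (Fin d) (Fin d) ℂ) - Y)) := fun M => by
    rw [Fin.sum_univ_add]
    simp only [Fin.append_left, Fin.append_right]
    rw [hA M, hB M]
  refine ⟨d + d, Fin.append (fun k => vecMulVec (⇑(hO.eigenvectorBasis j)) (A k))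
    (fun k => vecMulVec (⇑(hO.eigenvectorBasis i)) (B k)), 2 * c / (a - b), c * (a + b) / (a - b), by positivity, ?_, ?_⟩
  rotate_left
  · rw [hsum O, huO, huO, ← ha, ← hb]
    have : (a : ℂ) • ((1 / (2 * c) : ℝ) : ℂ) • ((c : ℂ) • (1 : Matrix (Fin d) (Fin d) ℂ) + Y)
        + (b : ℂ) • ((1 / (2 * c) : ℝ) : ℂ) • ((c : ℂ) • (1 : Matrix (Fin d) (Fin d) ℂ) - Y)
        = ((a + b) / 2 : ℂ) • (1 : Matrix (Fin d) (Fin d) ℂ) + ((a - b) / (2 * c) : ℂ) • Y := by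
      push_cast
      match_scalars <;> field_simp <;> ring
    rw [this]
    simp only [Matrix.mul_add, Matrix.add_mul, Finset.sum_add_distrib, Matrix.mul_smul,
      Matrix.smul_mul, Matrix.mul_one, ← Finset.smul_sum, hTP, hYO]
    push_cast
    match_scalars <;> field_simp
  · have := hsum 1
    simp only [Matrix.mul_one, Matrix.one_mulVec, huu, one_smul] at this
    rw [this]
    push_cast
    match_scalars <;> field_simp <;> ring
end

section
/- Let ε ∈ [0,1), let N_ε(ρ) = (1−ε)ρ + ε·tr(ρ)·I₂/2 be the qubit depolarizing channel, and let H = (I₄ + X⊗X + Y⊗Y + Z⊗Z)/2 be the swap operator on ℂ²⊗ℂ². Suppose f > 0 and t ∈ ℝ are real numbers and C is a quantum channel on 4×4 complex matrices (with Kraus operators Kⱼ, Σⱼ Kⱼ†Kⱼ = I₄) such that (N_ε ⊗ N_ε)†(C†(H)) = (1/f)·(H + t·I₄), where C†(Y) = Σⱼ Kⱼ†YKⱼ and (N_ε ⊗ N_ε)† is the trace-pairing adjoint of N_ε ⊗ N_ε. Then f ≥ 1/(1−ε)². (Optimality of the sampling overhead 1/(1−ε)² for retrieving the second moment under depolarizing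 noise.) -/
open Matrix BigOperators Kronecker

/-- Pauli X. -/
noncomputable def PX : Matrix (Fin 2) (Fin 2) ℂ := !![0, 1; 1, 0]
/-- Pauli Y. -/
noncomputable def PY : Matrix (Fin 2) (Fin 2) ℂ := !![0, -Complex.I; Complex.I, 0]
/-- Pauli Z. -/
noncomputable def PZ : Matrix (Fin 2) (Fin 2) ℂ := !![1, 0; 0, -1]

/-- The swap operator `H = (I₄ + X⊗X + Y⊗Y + Z⊗Z)/2` on `ℂ² ⊗ ℂ²`. -/
noncomputable def Hswap : Matrix (Fin 2 × Fin 2) (Fin 2 × Fin 2) ℂ :=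
  (1 / 2 : ℂ) • (1 + (PX ⊗ₖ PX + PY ⊗ₖ PY + PZ ⊗ₖ PZ))

/-- The qubit depolarizing channel `N_ε(ρ) = (1−ε)ρ + ε·tr(ρ)·I₂/2`. -/
noncomputable def Ndep (ε : ℝ) (ρ : Matrix (Fin 2) (Fin 2) ℂ) : Matrix (Fin 2) (Fin 2) ℂ :=
  ((1 - ε : ℝ) : ℂ) • ρ + ((ε / 2 : ℝ) : ℂ) • ρ.trace • (1 : Matrix (Fin 2) (Fin 2) ℂ)

lemma hswap_sq : Hswap * Hswap = 1 := by
  ext ⟨a, b⟩ ⟨c, d⟩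
  fin_cases a <;> fin_cases b <;> fin_cases c <;> fin_cases d <;>
    simp [Hswap, PX, PY, PZ, Matrix.mul_apply, Fintype.sum_prod_type, Matrix.one_apply] <;> norm_num

lemma hswap_herm : Hswapᴴ = Hswap := by
  ext ⟨a, b⟩ ⟨c, d⟩
  fin_cases a <;> fin_cases b <;> fin_cases c <;> fin_cases d <;>
    simp [Hswap, PX, PY, PZ] <;> norm_num

lemma hswap_trace : Hswap.trace = 2 := by
  simp [Hswap, PX, PY, PZ, Matrix.trace, Fintype.sum_prod_type]
  norm_num

open scoped ComplexOrder in
lemma trace_nonneg_aux {n : Type*} [Fintype n] [DecidableEq n] (P Q K : Matrix n n ℂ)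
    (hP : Pᴴ = P) (hQ : Qᴴ = Q) (hP2 : P * P = (2 : ℂ) • P) (hQ2 : Q * Q = (2 : ℂ) • Q) :
    0 ≤ (P * (Kᴴ * Q * K)).trace.re := by
  have h := (Matrix.posSemidef_conjTranspose_mul_self (Q * K * P)).trace_nonneg
  have e : ((Q * K * P)ᴴ * (Q * K * P)).trace = 4 * (P * (Kᴴ * Q * K)).trace := by
    have e1 : (Q * K * P)ᴴ * (Q * K * P) = P * (Kᴴ * (Q * Q) * K) * P := by
      simp only [Matrix.conjTranspose_mul, hP, hQ, Matrix.mul_assoc]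
    rw [e1, Matrix.trace_mul_comm, ← Matrix.mul_assoc, hP2, hQ2]
    simp only [Matrix.mul_smul, Matrix.smul_mul, Matrix.trace_smul, smul_eq_mul]
    ring
  rw [e] at h
  have := (Complex.le_def.1 h).1
  simp at this
  linarith

/-- optimality for depolarizing noise: let `N2` be the linear map `N_ε ⊗ N_ε`
(determined by `N2(A⊗B) = N_ε(A)⊗N_ε(B)`) and `N2adj` its trace-pairing adjoint.  If `f > 0`,
`t ∈ ℝ` and a quantum channel `C` with Kraus operators `K j` satisfy
`(N_ε⊗N_ε)†(C†(H)) = (1/f)·(H + t·I₄)`, then `f ≥ 1/(1−ε)²`. -/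
theorem depolarizing_overhead_optimal (ε : ℝ) (hε : 0 ≤ ε) (hε1 : ε < 1)
    (N2 N2adj : Matrix (Fin 2 × Fin 2) (Fin 2 × Fin 2) ℂ →ₗ[ℂ]
      Matrix (Fin 2 × Fin 2) (Fin 2 × Fin 2) ℂ)
    (hN2 : ∀ A B : Matrix (Fin 2) (Fin 2) ℂ, N2 (A ⊗ₖ B) = Ndep ε A ⊗ₖ Ndep ε B)
    (hadj : ∀ A B, (N2 A * B).trace = (A * N2adj B).trace)
    (f t : ℝ) (hf : 0 < f)
    (m : ℕ) (K : Fin m → Matrix (Fin 2 × Fin 2) (Fin 2 × Fin 2) ℂ)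
    (hTP : ∑ j, (K j)ᴴ * K j = 1)
    (hcond : N2adj (∑ j, (K j)ᴴ * Hswap * K j)
      = ((f⁻¹ : ℝ) : ℂ) • (Hswap + (t : ℂ) • (1 : Matrix (Fin 2 × Fin 2) (Fin 2 × Fin 2) ℂ))) :
    1 / (1 - ε) ^ 2 ≤ f := by
  set W := ∑ j, (K j)ᴴ * Hswap * K j with hW
  have hS : PX ⊗ₖ PX + PY ⊗ₖ PY + PZ ⊗ₖ PZ = (2 : ℂ) • Hswap - 1 := by
    simp [Hswap, smul_smul]
  have hP (A : Matrix (Fin 2) (Fin 2) ℂ) (hA : A.trace = 0) :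
      N2 (A ⊗ₖ A) = (((1 - ε) ^ 2 : ℝ) : ℂ) • (A ⊗ₖ A) := by
    rw [hN2]
    simp only [Ndep, hA, zero_smul, smul_zero, add_zero, Matrix.smul_kronecker,
      Matrix.kronecker_smul, smul_smul]
    push_cast
    congr 1
    ring
  have hN : N2 ((2 : ℂ) • Hswap - 1) = (((1 - ε) ^ 2 : ℝ) : ℂ) • ((2 : ℂ) • Hswap - 1) := by
    rw [← hS, map_add, map_add, hP PX (by simp [PX]), hP PY (by simp [PY]),
      hP PZ (by simp [PZ]), smul_add, smul_add]
  have h1 := hadj ((2 : ℂ) • Hswap - 1) W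
  have htr1 : (1 : Matrix (Fin 2 × Fin 2) (Fin 2 × Fin 2) ℂ).trace = 4 := by
    norm_num [Matrix.trace_one]
  rw [hN, hcond] at h1
  simp only [Matrix.smul_mul, Matrix.mul_smul, Matrix.sub_mul, Matrix.mul_add, Matrix.one_mul,
    Matrix.mul_one, hswap_sq, Matrix.trace_smul, Matrix.trace_sub, Matrix.trace_add, htr1,
    hswap_trace, smul_eq_mul] at h1
  have hm : (1 - Hswap)ᴴ = 1 - Hswap := by simp [hswap_herm]
  have hp : (1 + Hswap)ᴴ = 1 + Hswap := by simp [hswap_herm]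
  have hm2 : (1 - Hswap) * (1 - Hswap) = (2 : ℂ) • (1 - Hswap) := by
    simp only [sub_mul, mul_sub, hswap_sq, one_mul, mul_one, two_smul]; abel
  have hp2 : (1 + Hswap) * (1 + Hswap) = (2 : ℂ) • (1 + Hswap) := by
    simp only [add_mul, mul_add, hswap_sq, one_mul, mul_one, two_smul]; abel
  have hWm : ∑ j, (K j)ᴴ * (1 - Hswap) * K j = 1 - W := by
    simp only [mul_sub, sub_mul, mul_one, Finset.sum_sub_distrib, hTP, hW]
  have hWp : ∑ j, (K j)ᴴ * (1 + Hswap) * K j = 1 + W := by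
    simp only [mul_add, add_mul, mul_one, Finset.sum_add_distrib, hTP, hW]
  have i1 : 0 ≤ ((1 + Hswap) * (1 - W)).trace.re := by
    rw [← hWm, Matrix.mul_sum, Matrix.trace_sum, Complex.re_sum]
    exact Finset.sum_nonneg fun j _ => trace_nonneg_aux _ _ _ hp hm hp2 hm2
  have i2 : 0 ≤ ((1 - Hswap) * (1 + W)).trace.re := by
    rw [← hWp, Matrix.mul_sum, Matrix.trace_sum, Complex.re_sum]
    exact Finset.sum_nonneg fun j _ => trace_nonneg_aux _ _ _ hm hp hm2 hp2
  simp only [add_mul, sub_mul, mul_sub, mul_add, one_mul, mul_one, Matrix.trace_add,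
    Matrix.trace_sub, htr1, hswap_trace, Complex.add_re, Complex.sub_re] at i1 i2
  have h2 := congrArg Complex.re h1
  rw [Complex.re_ofReal_mul, Complex.re_ofReal_mul] at h2
  simp at h2 i1 i2
  have hs : 0 < (1 - ε) ^ 2 := by have : 0 < 1 - ε := by linarith
                                  positivity
  rw [div_le_iff₀ hs]
  have h3 : f⁻¹ ≤ (1 - ε) ^ 2 := by
    nlinarith
  have := mul_le_mul_of_nonneg_left h3 hf.le
  rwa [mul_inv_cancel₀ hf.ne'] at this
end

section
/- Let d ≥ 1, k ≥ 1, let N be a quantum channel on d×d complex matrices that is bijective as a linear map, and let H_k = (S_k + S_k†)/2 be the moment observable on ℂ^{d^k}. Define f_min(N,k) as the infimum of the set { f ∈ ℝ : f > 0 and there exist t ∈ ℝ and a quantum channel C on d^k×d^k matrices with (N^{⊗k})†(C†(H_k)) = (1/f)·(H_k + t·I) }, and define g_min(N,k) as the infimum of the set { Σᵢ |cᵢ| : there exist a finite family of reals cᵢ and quantum channels Cᵢ on d^k×d^k matrices with (N⁻¹)^{⊗k} = Σᵢ cᵢ·Cᵢ }. Then f_min(N,k) ≤ g_min(N,k). (The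 observable shift method never requires more sampling overhead than the quasi-probability channel inverse method.) -/
open Matrix BigOperators

/-- The cyclic permutation operator `S_k` on `(ℂ^d)^{⊗k} ≅ ℂ^{d^k}`. -/
noncomputable def cyclicPermOp (d k : ℕ) : Matrix (Fin k → Fin d) (Fin k → Fin d) ℂ :=
  Matrix.of fun a b => if ∀ j, a j = b (finRotate k j) then 1 else 0

/-- The moment observable `H_k = (S_k + S_k†)/2`. -/
noncomputable def momentObs (d k : ℕ) : Matrix (Fin k → Fin d) (Fin k → Fin d) ℂ :=
  (1 / 2 : ℂ) • (cyclicPermOp d k + (cyclicPermOp d k)ᴴ)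

/-- The Kronecker product `A₁ ⊗ ⋯ ⊗ A_k` of a family of `d × d` matrices. -/
noncomputable def kronMap {d k : ℕ} (A : Fin k → Matrix (Fin d) (Fin d) ℂ) :
    Matrix (Fin k → Fin d) (Fin k → Fin d) ℂ :=
  Matrix.of fun a b => ∏ j, A j (a j) (b j)

/-- A linear map on `n × n` complex matrices is a quantum channel if it admits a finite Kraus
representation `Φ(X) = Σᵢ KᵢXKᵢ†` with `Σᵢ Kᵢ†Kᵢ = I`. -/
def IsQChannel {n : Type*} [Fintype n] [DecidableEq n]
    (Φ : Matrix n n ℂ →ₗ[ℂ] Matrix n n ℂ) : Prop :=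
  ∃ (m : ℕ) (K : Fin m → Matrix n n ℂ),
    (∀ X, Φ X = ∑ i, K i * X * (K i)ᴴ) ∧ ∑ i, (K i)ᴴ * K i = 1

section helpers

variable {n : Type*} [Fintype n] [DecidableEq n]

lemma isQChannel_of_fintype {ι : Type*} [Fintype ι]
    (Φ : Matrix n n ℂ →ₗ[ℂ] Matrix n n ℂ) (K : ι → Matrix n n ℂ)
    (h1 : ∀ X, Φ X = ∑ i, K i * X * (K i)ᴴ) (h2 : ∑ i, (K i)ᴴ * K i = 1) :
    IsQChannel Φ := by
  refine ⟨Fintype.card ι, fun i => K ((Fintype.equivFin ι).symm i), ?_, ?_⟩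
  · intro X
    rw [h1, ← (Fintype.equivFin ι).symm.sum_comp]
  · rw [← h2, ← (Fintype.equivFin ι).symm.sum_comp]

lemma isQChannel_one : IsQChannel (1 : Module.End ℂ (Matrix n n ℂ)) :=
  ⟨1, fun _ => 1, by simp, by simp⟩

lemma isQChannel_mul {Φ Ψ : Module.End ℂ (Matrix n n ℂ)} (h : IsQChannel Φ)
    (h' : IsQChannel Ψ) : IsQChannel (Φ * Ψ) := by
  obtain ⟨m, K, hK, hK1⟩ := h
  obtain ⟨m', L, hL, hL1⟩ := h'
  refine isQChannel_of_fintype (ι := Fin m × Fin m') _ (fun p => K p.1 * L p.2) ?_ ?_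
  · intro X
    rw [Module.End.mul_apply, hK, hL, Fintype.sum_prod_type]
    refine Finset.sum_congr rfl fun i _ => ?_
    simp [Finset.mul_sum, Finset.sum_mul, Matrix.mul_assoc]
  · rw [Fintype.sum_prod_type_right]
    have : ∀ j, ∑ i, (K i * L j)ᴴ * (K i * L j) = (L j)ᴴ * (∑ i, (K i)ᴴ * K i) * L j := by
      intro j
      simp [Finset.mul_sum, Finset.sum_mul, Matrix.mul_assoc]
    simp only [this, hK1, Matrix.mul_one, hL1]

lemma isQChannel_pow {Φ : Module.End ℂ (Matrix n n ℂ)} (h : IsQChannel Φ) (j : ℕ) :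
    IsQChannel (Φ ^ j) := by
  induction j with
  | zero => exact isQChannel_one
  | succ j ih => rw [pow_succ]; exact isQChannel_mul ih h

lemma kraus_trace {ι : Type*} [Fintype ι] (K : ι → Matrix n n ℂ) (X Y : Matrix n n ℂ) :
    ((∑ i, K i * X * (K i)ᴴ) * Y).trace = (X * ∑ i, (K i)ᴴ * Y * K i).trace := by
  simp only [Finset.sum_mul, Finset.mul_sum, Matrix.trace_sum]
  refine Finset.sum_congr rfl fun i _ => ?_
  rw [Matrix.mul_assoc, Matrix.mul_assoc, Matrix.trace_mul_comm]
  simp [Matrix.mul_assoc]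

lemma ext_trace {A B : Matrix n n ℂ} (h : ∀ X : Matrix n n ℂ, (X * A).trace = (X * B).trace) :
    A = B := by
  ext i j
  have := h (Matrix.single j i 1)
  simpa [Matrix.trace_single_mul] using this

/-- a bijective channel has an inverse that is a real combination of channels. -/
lemma inverse_decomp (Φ D : Module.End ℂ (Matrix n n ℂ)) (h : IsQChannel Φ) (hD : D * Φ = 1) :
    ∃ (m : ℕ) (c : Fin m → ℝ) (C : Fin m → (Matrix n n ℂ →ₗ[ℂ] Matrix n n ℂ)),
      (∀ i, IsQChannel (C i)) ∧ ∀ X, D X = ∑ i, ((c i : ℝ) : ℂ) • C i X := by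
  haveI : Module.Finite ℝ (Module.End ℂ (Matrix n n ℂ)) := Module.Finite.trans ℂ _
  have hint : IsIntegral ℝ Φ := Algebra.IsIntegral.isIntegral Φ
  have hD' : Φ * D = 1 := mul_eq_one_comm.mp hD
  set p := minpoly ℝ Φ with hp
  have hne : p ≠ 0 := minpoly.ne_zero hint
  have haev : Polynomial.aeval Φ p = 0 := minpoly.aeval ℝ Φ
  have hdec := Polynomial.divX_mul_X_add p
  have hkey : Polynomial.aeval Φ p.divX * Φ + algebraMap ℝ _ (p.coeff 0) = 0 := by
    rw [← haev]
    conv_rhs => rw [← hdec]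
    simp
  have h0 : p.coeff 0 ≠ 0 := by
    intro h0
    rw [h0, map_zero, add_zero] at hkey
    have hz : Polynomial.aeval Φ p.divX = 0 := by
      calc _ = Polynomial.aeval Φ p.divX * (Φ * D) := by rw [hD', mul_one]
        _ = 0 := by rw [← mul_assoc, hkey, zero_mul]
    rw [h0, map_zero, add_zero] at hdec
    have hne' : p.divX ≠ 0 := by
      intro h; rw [h, zero_mul] at hdec; exact hne hdec.symm
    have := minpoly.degree_le_of_ne_zero ℝ Φ hne' hz
    rw [← hp] at this
    exact absurd (Polynomial.degree_divX_lt hne) (not_lt.mpr this)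
  have hDeq : D = (-(p.coeff 0)⁻¹ : ℝ) • Polynomial.aeval Φ p.divX := by
    have h1 : Polynomial.aeval Φ p.divX + (p.coeff 0) • D = 0 := by
      have := congrArg (· * D) hkey
      simpa [add_mul, mul_assoc, hD', Algebra.algebraMap_eq_smul_one] using this
    have h2 : Polynomial.aeval Φ p.divX = -((p.coeff 0) • D) := eq_neg_of_add_eq_zero_left h1
    rw [h2, smul_neg, neg_smul, neg_neg, smul_smul, inv_mul_cancel₀ h0, one_smul]
  refine ⟨p.divX.natDegree + 1, fun i => -(p.coeff 0)⁻¹ * p.divX.coeff i, fun i => Φ ^ (i : ℕ),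
    fun i => isQChannel_pow h _, fun X => ?_⟩
  rw [hDeq, Polynomial.aeval_eq_sum_range, Finset.sum_range, Finset.smul_sum,
    LinearMap.sum_apply]
  refine Finset.sum_congr rfl fun i _ => ?_
  rw [smul_smul, LinearMap.smul_apply]
  ext a b
  simp

/-- negation-with-shift channel -/
lemma neg_shift [Nonempty n] (H : Matrix n n ℂ) (hH : H.IsHermitian) :
    ∃ (s : ℝ) (L : n × Bool → Matrix n n ℂ),
      ∑ i, (L i)ᴴ * L i = 1 ∧ ∑ i, (L i)ᴴ * H * L i = (s : ℂ) • 1 - H := by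
  obtain ⟨j1, hj1⟩ := Finite.exists_max hH.eigenvalues
  obtain ⟨j0, hj0⟩ := Finite.exists_min hH.eigenvalues
  set ev := hH.eigenvalues with hev
  have hp : ∀ j, ∃ p q : ℝ, 0 ≤ p ∧ 0 ≤ q ∧ p + q = 1 ∧
      p * ev j1 + q * ev j0 = ev j1 + ev j0 - ev j := by
    intro j
    rcases eq_or_lt_of_le (hj0 j1) with h | h
    · refine ⟨1, 0, by norm_num, by norm_num, by norm_num, ?_⟩
      have := hj1 j; have := hj0 j; linarith
    · have hpos : 0 < ev j1 - ev j0 := sub_pos.mpr h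
      refine ⟨(ev j1 - ev j) / (ev j1 - ev j0), (ev j - ev j0) / (ev j1 - ev j0),
        div_nonneg (sub_nonneg.mpr (hj1 j)) hpos.le, div_nonneg (sub_nonneg.mpr (hj0 j)) hpos.le,
        ?_, ?_⟩
      · field_simp; ring
      · field_simp; ring
  choose p q hp0 hq0 hpq hval using hp
  let U : Matrix n n ℂ := (hH.eigenvectorUnitary : Matrix n n ℂ)
  have hU1 : Uᴴ * U = 1 := Unitary.coe_star_mul_self hH.eigenvectorUnitary
  have hU2 : U * Uᴴ = 1 := Unitary.coe_mul_star_self hH.eigenvectorUnitary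
  let Λ : Matrix n n ℂ := Matrix.diagonal fun j => (ev j : ℂ)
  have hHd : H = U * Λ * Uᴴ := by
    have := hH.spectral_theorem
    simpa [Unitary.conjStarAlgAut_apply, U, Λ, Function.comp_def, Matrix.star_eq_conjTranspose]
      using this
  let M : n × Bool → Matrix n n ℂ := fun x =>
    if x.2 then Matrix.single j1 x.1 ((Real.sqrt (p x.1) : ℝ) : ℂ)
    else Matrix.single j0 x.1 ((Real.sqrt (q x.1) : ℝ) : ℂ)
  have hsq : ∀ r : ℝ, 0 ≤ r → ((Real.sqrt r : ℝ) : ℂ) * ((Real.sqrt r : ℝ) : ℂ) = r := by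
    intro r hr; rw [← Complex.ofReal_mul, Real.mul_self_sqrt hr]
  have hM1 : ∑ i, (M i)ᴴ * M i = 1 := by
    rw [Fintype.sum_prod_type]
    have : ∀ j, ∑ b, (M (j, b))ᴴ * M (j, b) = Matrix.single j j 1 := by
      intro j
      simp only [Fintype.sum_bool, M, if_true, Matrix.conjTranspose_single,
        Matrix.single_mul_single_same, Bool.false_eq_true, if_false, Complex.star_def,
        Complex.conj_ofReal, hsq _ (hp0 j), hsq _ (hq0 j), ← Matrix.single_add]
      rw [← Complex.ofReal_add, hpq, Complex.ofReal_one]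
    simp only [this]
    exact Matrix.sum_single_one
  have hsd : ∀ (i j : n) (z : ℂ), Matrix.single i j z * Λ = Matrix.single i j (z * (ev j : ℂ)) := by
    intro i j z
    ext a b
    by_cases hb : j = b
    · subst hb; by_cases ha : i = a <;> simp [Λ, Matrix.mul_diagonal, Matrix.single_apply, ha]
    · simp [Λ, Matrix.mul_diagonal, Matrix.single_apply, hb]
  have hM2 : ∑ i, (M i)ᴴ * Λ * M i = ((ev j1 + ev j0 : ℝ) : ℂ) • 1 - Λ := by
    rw [Fintype.sum_prod_type]
    have : ∀ j, ∑ b, (M (j, b))ᴴ * Λ * M (j, b)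
        = Matrix.single j j ((ev j1 + ev j0 - ev j : ℝ) : ℂ) := by
      intro j
      simp only [Fintype.sum_bool, M, if_true, Matrix.conjTranspose_single, hsd,
        Matrix.single_mul_single_same, Bool.false_eq_true, if_false, Complex.star_def,
        Complex.conj_ofReal, ← Matrix.single_add]
      congr 1
      rw [← hval j, Complex.ofReal_add, Complex.ofReal_mul, Complex.ofReal_mul,
        ← hsq _ (hp0 j), ← hsq _ (hq0 j)]
      ring
    simp only [this]
    rw [Matrix.sum_single_eq_diagonal]
    ext a b
    by_cases hab : a = b
    · subst hab; simp [Λ]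
    · simp [Λ, hab]
  refine ⟨ev j1 + ev j0, fun i => U * M i * Uᴴ, ?_, ?_⟩
  · have : ∀ i, (U * M i * Uᴴ)ᴴ * (U * M i * Uᴴ) = U * ((M i)ᴴ * M i) * Uᴴ := by
      intro i
      simp only [Matrix.conjTranspose_mul, Matrix.conjTranspose_conjTranspose]
      calc _ = U * (M i)ᴴ * (Uᴴ * U) * M i * Uᴴ := by simp only [Matrix.mul_assoc]
        _ = _ := by rw [hU1, Matrix.mul_one]; simp only [Matrix.mul_assoc]
    simp only [this]
    rw [← Finset.sum_mul, ← Finset.mul_sum, hM1, Matrix.mul_one, hU2]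
  · have : ∀ i, (U * M i * Uᴴ)ᴴ * H * (U * M i * Uᴴ) = U * ((M i)ᴴ * Λ * M i) * Uᴴ := by
      intro i
      rw [hHd]
      simp only [Matrix.conjTranspose_mul, Matrix.conjTranspose_conjTranspose]
      calc _ = U * (M i)ᴴ * (Uᴴ * U) * Λ * (Uᴴ * U) * M i * Uᴴ := by simp only [Matrix.mul_assoc]
        _ = _ := by rw [hU1, Matrix.mul_one, Matrix.mul_one]; simp only [Matrix.mul_assoc]
    simp only [this]
    rw [← Finset.sum_mul, ← Finset.mul_sum, hM2, Matrix.mul_sub, Matrix.sub_mul, ← hHd,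
      Matrix.mul_smul, Matrix.smul_mul, Matrix.mul_one, hU2]

/-- combining channels into one. -/
lemma combine [Nonempty n] (H : Matrix n n ℂ) (hH : H.IsHermitian) (m : ℕ) (c : Fin m → ℝ)
    (r : Fin m → ℕ) (K : (i : Fin m) → Fin (r i) → Matrix n n ℂ)
    (hK : ∀ i, ∑ a, (K i a)ᴴ * K i a = 1) (g : ℝ) (hg : g = ∑ i, |c i|) (hpos : 0 < g) :
    ∃ (t : ℝ) (m' : ℕ) (L : Fin m' → Matrix n n ℂ), ∑ i, (L i)ᴴ * L i = 1 ∧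
      ∑ i, (L i)ᴴ * H * L i = ((g⁻¹ : ℝ) : ℂ) •
        ((∑ i, ((c i : ℝ) : ℂ) • ∑ a, (K i a)ᴴ * H * K i a) + (t : ℂ) • 1) := by
  obtain ⟨s, D, hD1, hD2⟩ := neg_shift H hH
  -- for each `i` a signed family
  have step : ∀ i, ∃ (t : ℝ) (F : Fin (r i) × (n × Bool) → Matrix n n ℂ),
      ∑ x, (F x)ᴴ * F x = ((|c i| / g : ℝ) : ℂ) • 1 ∧
      ∑ x, (F x)ᴴ * H * F x = ((g⁻¹ : ℝ) : ℂ) •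
        (((c i : ℝ) : ℂ) • (∑ a, (K i a)ᴴ * H * K i a) + (t : ℂ) • 1) := by
    intro i
    have hw0 : 0 ≤ |c i| / g := div_nonneg (abs_nonneg _) hpos.le
    have hgen : ∀ (E : n × Bool → Matrix n n ℂ) (Y : Matrix n n ℂ),
        ∑ x : Fin (r i) × (n × Bool),
          ((((Real.sqrt (|c i| / g) : ℝ) : ℂ) • (E x.2 * K i x.1))ᴴ * Y *
            (((Real.sqrt (|c i| / g) : ℝ) : ℂ) • (E x.2 * K i x.1)))
        = ((|c i| / g : ℝ) : ℂ) • ∑ a, (K i a)ᴴ * (∑ b, (E b)ᴴ * Y * E b) * K i a := by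
      intro E Y
      rw [Fintype.sum_prod_type, Finset.smul_sum]
      refine Finset.sum_congr rfl fun a _ => ?_
      rw [Finset.mul_sum, Finset.sum_mul, Finset.smul_sum]
      refine Finset.sum_congr rfl fun b _ => ?_
      simp only [Matrix.conjTranspose_smul, Matrix.conjTranspose_mul, Matrix.smul_mul,
        Matrix.mul_smul, smul_smul, Complex.star_def, Complex.conj_ofReal]
      rw [← Complex.ofReal_mul, Real.mul_self_sqrt hw0]
      simp only [Matrix.mul_assoc]
    rcases le_or_gt 0 (c i) with hc | hc
    · -- identity family
      obtain ⟨x0⟩ := (inferInstance : Nonempty n)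
      let E : n × Bool → Matrix n n ℂ := fun b => if b = (x0, true) then 1 else 0
      have hE : ∀ Y, ∑ b, (E b)ᴴ * Y * E b = Y := by
        intro Y
        rw [Finset.sum_eq_single (x0, true)]
        · simp [E]
        · intro b _ hb; simp [E, hb]
        · simp
      refine ⟨0, fun x => ((Real.sqrt (|c i| / g) : ℝ) : ℂ) • (E x.2 * K i x.1), ?_, ?_⟩
      · have := hgen E 1
        rw [hE] at this
        simp only [Matrix.mul_one] at this
        rw [this, hK]
      · rw [hgen E H, hE, abs_of_nonneg hc]
        simp only [Complex.ofReal_zero, zero_smul, add_zero, smul_smul]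
        congr 1
        push_cast; ring
    · refine ⟨|c i| * s, fun x => ((Real.sqrt (|c i| / g) : ℝ) : ℂ) • (D x.2 * K i x.1), ?_, ?_⟩
      · have := hgen D 1
        simp only [Matrix.mul_one, hD1] at this
        rw [this, hK]
      · rw [hgen D H, hD2, abs_of_neg hc]
        have : ∑ a, (K i a)ᴴ * ((s : ℂ) • 1 - H) * K i a
            = (s : ℂ) • 1 - ∑ a, (K i a)ᴴ * H * K i a := by
          simp only [Matrix.mul_sub, Matrix.sub_mul, Finset.sum_sub_distrib, Matrix.mul_smul,
            Matrix.smul_mul, Matrix.mul_one]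
          rw [← Finset.smul_sum, hK i]
        rw [this]
        push_cast
        module
  choose t F hF1 hF2 using step
  let e := Fintype.equivFin (Σ i : Fin m, Fin (r i) × (n × Bool))
  refine ⟨∑ i, t i, _, fun y => F (e.symm y).1 (e.symm y).2, ?_, ?_⟩
  · rw [e.symm.sum_comp (fun y => (F y.1 y.2)ᴴ * F y.1 y.2), Fintype.sum_sigma]
    simp only [hF1]
    rw [← Finset.sum_smul, ← Complex.ofReal_sum, ← Finset.sum_div, ← hg, div_self hpos.ne',
      Complex.ofReal_one, one_smul]
  · rw [e.symm.sum_comp (fun y => (F y.1 y.2)ᴴ * H * F y.1 y.2), Fintype.sum_sigma]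
    simp only [hF2]
    rw [← Finset.smul_sum, Finset.sum_add_distrib, ← Finset.sum_smul, ← Complex.ofReal_sum]

end helpers

section kron

variable {d k : ℕ}

lemma kronMap_mul (A B : Fin k → Matrix (Fin d) (Fin d) ℂ) :
    kronMap A * kronMap B = kronMap fun j => A j * B j := by
  ext a b
  simp only [kronMap, Matrix.mul_apply, Matrix.of_apply, Finset.prod_univ_sum,
    Fintype.piFinset_univ, Finset.prod_mul_distrib]

lemma kronMap_conjTranspose (A : Fin k → Matrix (Fin d) (Fin d) ℂ) :
    (kronMap A)ᴴ = kronMap fun j => (A j)ᴴ := by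
  ext a b
  simp [kronMap]

lemma kronMap_one : kronMap (fun _ : Fin k => (1 : Matrix (Fin d) (Fin d) ℂ)) = 1 := by
  ext a b
  simp only [kronMap, Matrix.of_apply, Matrix.one_apply]
  by_cases h : a = b
  · simp [h]
  · rw [if_neg h]
    obtain ⟨j, hj⟩ := Function.ne_iff.mp h
    exact Finset.prod_eq_zero (Finset.mem_univ j) (if_neg hj)

lemma kronMap_sum {m : ℕ} (A : Fin k → Fin m → Matrix (Fin d) (Fin d) ℂ) :
    kronMap (fun j => ∑ i, A j i) = ∑ s : Fin k → Fin m, kronMap fun j => A j (s j) := by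
  ext a b
  simp only [kronMap, Matrix.of_apply, Matrix.sum_apply, Finset.prod_univ_sum,
    Fintype.piFinset_univ]

lemma kronMap_single (a b : Fin k → Fin d) :
    kronMap (fun j => Matrix.single (a j) (b j) (1 : ℂ)) = Matrix.single a b 1 := by
  ext x y
  simp only [kronMap, Matrix.of_apply, Matrix.single_apply]
  by_cases h : a = x ∧ b = y
  · obtain ⟨rfl, rfl⟩ := h; simp
  · rw [if_neg h]
    have : ∃ j, ¬ (a j = x j ∧ b j = y j) := by
      by_contra hc
      push Not at hc
      exact h ⟨funext fun j => (hc j).1, funext fun j => (hc j).2⟩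
    obtain ⟨j, hj⟩ := this
    exact Finset.prod_eq_zero (Finset.mem_univ j) (if_neg hj)

lemma ext_kron {Φ Ψ : Matrix (Fin k → Fin d) (Fin k → Fin d) ℂ →ₗ[ℂ]
      Matrix (Fin k → Fin d) (Fin k → Fin d) ℂ}
    (h : ∀ A : Fin k → Matrix (Fin d) (Fin d) ℂ, Φ (kronMap A) = Ψ (kronMap A)) : Φ = Ψ := by
  refine (Matrix.stdBasis ℂ (Fin k → Fin d) (Fin k → Fin d)).ext ?_
  rintro ⟨a, b⟩
  rw [Matrix.stdBasis_eq_single]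
  have := h (fun j => Matrix.single (a j) (b j) (1 : ℂ))
  rw [kronMap_single] at this
  exact this

lemma momentObs_isHermitian : (momentObs d k).IsHermitian := by
  unfold momentObs Matrix.IsHermitian
  rw [Matrix.conjTranspose_smul, Matrix.conjTranspose_add, Matrix.conjTranspose_conjTranspose,
    add_comm]
  congr 1
  simp

lemma isQChannel_tensor {N : Matrix (Fin d) (Fin d) ℂ →ₗ[ℂ] Matrix (Fin d) (Fin d) ℂ}
    (hN : IsQChannel N)
    {Nk : Matrix (Fin k → Fin d) (Fin k → Fin d) ℂ →ₗ[ℂ]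
      Matrix (Fin k → Fin d) (Fin k → Fin d) ℂ}
    (hNk : ∀ A : Fin k → Matrix (Fin d) (Fin d) ℂ,
      Nk (kronMap A) = kronMap fun j => N (A j)) : IsQChannel Nk := by
  obtain ⟨m, K, hK, hK1⟩ := hN
  let L : (Fin k → Fin m) → Matrix (Fin k → Fin d) (Fin k → Fin d) ℂ :=
    fun s => kronMap fun j => K (s j)
  refine isQChannel_of_fintype Nk L ?_ ?_
  · let Ψ : Matrix (Fin k → Fin d) (Fin k → Fin d) ℂ →ₗ[ℂ]
      Matrix (Fin k → Fin d) (Fin k → Fin d) ℂ :=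
      ∑ s, (LinearMap.mulRight ℂ (L s)ᴴ) ∘ₗ (LinearMap.mulLeft ℂ (L s))
    have hΨ : ∀ X, Ψ X = ∑ s, L s * X * (L s)ᴴ := by
      intro X; simp [Ψ, LinearMap.sum_apply]
    have : Nk = Ψ := by
      apply ext_kron
      intro A
      rw [hNk, hΨ]
      simp only [hK, L, kronMap_conjTranspose, kronMap_mul]
      exact kronMap_sum (fun j i => K i * A j * (K i)ᴴ)
    intro X; rw [this, hΨ]
  · simp only [L, kronMap_conjTranspose, kronMap_mul]
    rw [← kronMap_sum (fun _ i => (K i)ᴴ * K i)]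
    simp only [hK1, kronMap_one]

end kron

/-- for an invertible quantum channel `N`, the optimal sampling overhead
`f_min(N,k)` of the observable shift method is at most the optimal sampling overhead
`g_min(N,k)` of the quasi-probability channel-inverse method.  Here `Nk` is the tensor power
`N^{⊗k}`, `Nkadj` its trace-pairing adjoint, and `Dinv` the tensor power `(N⁻¹)^{⊗k}`, each
characterized by its defining property. -/
theorem observableShift_overhead_le_QPD_overhead (d k : ℕ) (hd : 1 ≤ d) (hk : 1 ≤ k)
    (N : Matrix (Fin d) (Fin d) ℂ →ₗ[ℂ] Matrix (Fin d) (Fin d) ℂ)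
    (hN : IsQChannel N) (hbij : Function.Bijective ⇑N)
    (Nk Nkadj Dinv : Matrix (Fin k → Fin d) (Fin k → Fin d) ℂ →ₗ[ℂ]
      Matrix (Fin k → Fin d) (Fin k → Fin d) ℂ)
    (hNk : ∀ A : Fin k → Matrix (Fin d) (Fin d) ℂ,
      Nk (kronMap A) = kronMap fun j => N (A j))
    (hNkadj : ∀ A B, (Nk A * B).trace = (A * Nkadj B).trace)
    (hDinv : ∀ A : Fin k → Matrix (Fin d) (Fin d) ℂ,
      Dinv (kronMap fun j => N (A j)) = kronMap A) :
    sInf {f : ℝ | 0 < f ∧ ∃ (t : ℝ) (m : ℕ)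
        (K : Fin m → Matrix (Fin k → Fin d) (Fin k → Fin d) ℂ),
        (∑ i, (K i)ᴴ * K i = 1) ∧
        Nkadj (∑ i, (K i)ᴴ * momentObs d k * K i)
          = ((f⁻¹ : ℝ) : ℂ) • (momentObs d k + (t : ℂ) • 1)}
      ≤ sInf {g : ℝ | ∃ (m : ℕ) (c : Fin m → ℝ)
        (C : Fin m → (Matrix (Fin k → Fin d) (Fin k → Fin d) ℂ →ₗ[ℂ]
          Matrix (Fin k → Fin d) (Fin k → Fin d) ℂ)),
        (∀ i, IsQChannel (C i)) ∧ (∀ X, Dinv X = ∑ i, ((c i : ℝ) : ℂ) • C i X) ∧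
        g = ∑ i, |c i|} := by
  have hch : IsQChannel Nk := isQChannel_tensor hN hNk
  have hDN : ∀ X, Dinv (Nk X) = X := by
    have : Dinv ∘ₗ Nk = LinearMap.id := by
      apply ext_kron
      intro A
      rw [LinearMap.comp_apply, hNk, hDinv, LinearMap.id_apply]
    intro X
    exact LinearMap.congr_fun this X
  haveI : Nonempty (Fin k → Fin d) := ⟨fun _ => ⟨0, hd⟩⟩
  have hone : Nkadj 1 = 1 := by
    apply ext_trace
    intro X
    rw [← hNkadj]
    obtain ⟨m, K, hK, hK1⟩ := hch
    rw [hK, kraus_trace]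
    simp only [Matrix.mul_one, hK1]
  apply csInf_le_csInf
  · exact ⟨0, fun f hf => hf.1.le⟩
  · obtain ⟨m, c, C, hC, h⟩ := inverse_decomp Nk Dinv hch (LinearMap.ext hDN)
    exact ⟨_, m, c, C, hC, h, rfl⟩
  · rintro g ⟨m, c, C, hC, hdec, hg⟩
    have hpos : 0 < g := by
      have h0 : 0 ≤ g := hg ▸ Finset.sum_nonneg fun i _ => abs_nonneg _
      refine lt_of_le_of_ne h0 fun hz => ?_
      rw [hg] at hz
      have hall := (Finset.sum_eq_zero_iff_of_nonneg fun i _ => abs_nonneg (c i)).mp hz.symm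
      have h1 := hDN 1
      rw [hdec, Finset.sum_eq_zero] at h1
      · exact zero_ne_one h1
      · intro i hi
        rw [abs_eq_zero.mp (hall i hi), Complex.ofReal_zero, zero_smul]
    choose r K hK hK1 using hC
    obtain ⟨t, m', L, hL1, hL2⟩ :=
      combine (momentObs d k) momentObs_isHermitian m c r K hK1 g hg hpos
    refine ⟨hpos, t, m', L, hL1, ?_⟩
    rw [hL2, map_smul, map_add, map_smul, hone]
    congr 2
    apply ext_trace
    intro X
    rw [← hNkadj]
    conv_rhs => rw [← hDN X, hdec]
    simp only [Finset.mul_sum, Finset.sum_mul, Matrix.trace_sum, Matrix.mul_smul, Matrix.smul_mul,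
      Matrix.trace_smul]
    refine Finset.sum_congr rfl fun i _ => ?_
    congr 1
    rw [hK, kraus_trace, Finset.mul_sum, Matrix.trace_sum]
end
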